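/- arXiv:1309.1237 — 2 statements merged into one kernel-verified Lean document; each statement's English description precedes it below -/
import Mathlib

section
/- Let A = ℤ⟨x,y⟩/(yx - qxy) with q an integer, q ≠ ±1. With the ℤ²-grading where deg x = (1,0) and deg y = (0,1), the degree (i,j) component of the second lower central series quotient B₂(A) = L₂(A)/L₃(A) is isomorphic to ℤ/(q-1) when i,j > 0 and i+j > 2, to ℤ when i = j = 1, and is 0 when i = 0 or j = 0. -/
open FreeAlgebra

/-- The defining relation `yx = q·xy` of the q-polynomial algebra. -/
def qRel (q : ℤ) : FreeAlgebra ℤ (Fin 2) → FreeAlgebra ℤ (Fin 2) → Prop :=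
  fun a b => a = ι ℤ (1 : Fin 2) * ι ℤ (0 : Fin 2) ∧
    b = q • (ι ℤ (0 : Fin 2) * ι ℤ (1 : Fin 2))

/-- The q-polynomial algebra `A = ℤ⟨x,y⟩/(yx - qxy)`. -/
def QPoly (q : ℤ) : Type := RingQuot (qRel q)

noncomputable instance (q : ℤ) : Ring (QPoly q) :=
  inferInstanceAs (Ring (RingQuot (qRel q)))

noncomputable instance (q : ℤ) : Algebra ℤ (QPoly q) :=
  inferInstanceAs (Algebra ℤ (RingQuot (qRel q)))

/-- The span of words in `x`, `y` containing `i` letters `x` and `j` letters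
`y`: the degree-`(i,j)` component of `ℤ⟨x,y⟩`. -/
noncomputable def freeDeg (i j : ℕ) : Submodule ℤ (FreeAlgebra ℤ (Fin 2)) :=
  Submodule.span ℤ
    {x | ∃ w : List (Fin 2), w.count (0 : Fin 2) = i ∧ w.count (1 : Fin 2) = j ∧
      x = (w.map (ι ℤ)).prod}

/-- The degree-`(i,j)` component of the q-polynomial algebra. -/
noncomputable def qDeg (q : ℤ) (i j : ℕ) : Submodule ℤ (QPoly q) :=
  Submodule.map (RingQuot.mkAlgHom ℤ (qRel q)).toLinearMap (freeDeg i j)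

/-- The lower central series `L_k` of the q-polynomial algebra
(`lcs q k` is `L_k` for `k ≥ 1`; `lcs q 0 = ⊤` is a junk value). -/
noncomputable def lcs (q : ℤ) : ℕ → Submodule ℤ (QPoly q)
  | 0 => ⊤
  | 1 => ⊤
  | (k + 2) =>
      Submodule.span ℤ {x | ∃ a l, l ∈ lcs q (k + 1) ∧ x = a * l - l * a}

/-- The degree-`(i,j)` component of `B₂(A) = L₂(A)/L₃(A)`: the quotient of
`L₂ ∩ A[i,j]` by its intersection with `L₃`. -/
noncomputable abbrev B2comp (q : ℤ) (i j : ℕ) :=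
  ↥(lcs q 2 ⊓ qDeg q i j) ⧸
    Submodule.comap (lcs q 2 ⊓ qDeg q i j).subtype (lcs q 3)

theorem sub_one_pow_dvd_pow_sub_pow {q : ℤ} {g m n : ℕ} (h : m ≡ n [MOD g]) :
    q ^ g - 1 ∣ q ^ m - q ^ n := by
  wlog hmn : m ≤ n generalizing m n
  · exact (dvd_sub_comm).1 (this h.symm (by omega))
  obtain ⟨k, hk⟩ := (Nat.modEq_iff_dvd' hmn).1 h
  obtain rfl : n = m + g * k := by omega
  rw [pow_add, pow_mul, dvd_sub_comm]
  have := sub_one_dvd_pow_sub_one (q ^ g) k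
  simpa [mul_sub] using this.mul_left (q ^ m)

theorem exists_pow_gcd_sub_one (q : ℤ) (m n : ℕ) :
    ∃ u v : ℤ, u * (q ^ m - 1) + v * (q ^ n - 1) = q ^ m.gcd n - 1 := by
  rw [← Ideal.mem_span_pair, ← Ideal.Quotient.eq, map_pow, map_one]
  refine pow_gcd_eq_one.2 ⟨?_, ?_⟩ <;> rw [← map_pow, ← map_one (Ideal.Quotient.mk _),
    Ideal.Quotient.eq] <;> exact Ideal.subset_span (by simp)

theorem pow_sub_one_ne_zero {q : ℤ} (hq : q ≠ 1) (hq' : q ≠ -1) {n : ℕ} (hn : n ≠ 0) :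
    q ^ n - 1 ≠ 0 := fun h ↦
  (Int.isUnit_iff.1 (IsUnit.of_pow_eq_one (sub_eq_zero.1 h) hn)).elim hq hq'

/-- If `m` and `n` are coprime, then so are `(q ^ m - 1) / (q - 1)` and a cofactor of `q ^ n - 1`. -/
theorem isCoprime_of_pow_sub_one {q a b c d : ℤ} (hq : q ≠ 1) {m n : ℕ} (h : m.Coprime n)
    (ha : q ^ m - 1 = (q - 1) * c * a) (hb : q ^ n - 1 = (q - 1) * d * b) : IsCoprime a b := by
  obtain ⟨u, v, huv⟩ := exists_pow_gcd_sub_one q m n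
  rw [h, pow_one] at huv
  refine ⟨u * c, v * d, mul_left_cancel₀ (sub_ne_zero.2 hq) ?_⟩
  linear_combination huv - u * ha - v * hb

theorem exists_bezout_sub_one_mul {q : ℤ} (hq : q ≠ 1) (hq' : q ≠ -1) {i j : ℕ}
    (hi : 0 < i) (hj : 0 < j) :
    ∃ u v : ℤ, u * ((q ^ (i - 1).gcd j - 1) * (q ^ j - 1)) +
      v * ((q ^ i.gcd (j - 1) - 1) * (q ^ i - 1)) = (q - 1) * (q ^ i.gcd j - 1) := by
  have key : ∀ {m n : ℕ}, m ∣ n → q ^ m - 1 ∣ q ^ n - 1 := by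
    rintro m _ ⟨k, rfl⟩
    simpa [pow_mul] using sub_one_dvd_pow_sub_one (q ^ m) k
  have one : ∀ n, q - 1 ∣ q ^ n - 1 := sub_one_dvd_pow_sub_one q
  obtain ⟨I, hI⟩ := key (Nat.gcd_dvd_left i j)
  obtain ⟨J, hJ⟩ := key (Nat.gcd_dvd_right i j)
  obtain ⟨G, hG⟩ := one (i.gcd j)
  obtain ⟨P, hP⟩ := one ((i - 1).gcd j)
  obtain ⟨Q, hQ⟩ := one (i.gcd (j - 1))
  have ci : (i - 1).Coprime i := by
    obtain ⟨i, rfl⟩ := Nat.exists_eq_succ_of_ne_zero hi.ne'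
    simp
  have cj : (j - 1).Coprime j := by
    obtain ⟨j, rfl⟩ := Nat.exists_eq_succ_of_ne_zero hj.ne'
    simp
  have hIJ : IsCoprime I J := by
    obtain ⟨u, v, huv⟩ := exists_pow_gcd_sub_one q i j
    refine ⟨u, v, mul_left_cancel₀
      (pow_sub_one_ne_zero hq hq' (Nat.gcd_pos_of_pos_left j hi).ne') ?_⟩
    linear_combination huv - u * hI - v * hJ
  have hPQ : IsCoprime P Q := isCoprime_of_pow_sub_one (c := 1) (d := 1) hq
    ((ci.coprime_dvd_left (Nat.gcd_dvd_left _ _)).coprime_dvd_right (Nat.gcd_dvd_left _ _))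
    (by simpa using hP) (by simpa using hQ)
  have hPI : IsCoprime P I := isCoprime_of_pow_sub_one (c := 1) (d := G) hq
    (ci.coprime_dvd_left (Nat.gcd_dvd_left _ _)) (by simpa using hP) (by rw [hI, hG])
  have hQJ : IsCoprime Q J := isCoprime_of_pow_sub_one (c := 1) (d := G) hq
    (cj.coprime_dvd_left (Nat.gcd_dvd_right _ _)) (by simpa using hQ) (by rw [hJ, hG])
  obtain ⟨u, v, huv⟩ : IsCoprime (P * J) (Q * I) :=
    (hPQ.mul_right hPI).mul_left (hQJ.symm.mul_right hIJ.symm)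
  refine ⟨u, v, ?_⟩
  rw [hP, hQ, hI, hJ]
  linear_combination (q - 1) * (q ^ i.gcd j - 1) * huv

namespace QPoly

variable (q : ℤ)

/-- The quotient map from the free algebra. -/
noncomputable def mk : FreeAlgebra ℤ (Fin 2) →ₐ[ℤ] QPoly q := RingQuot.mkAlgHom ℤ (qRel q)

/-- The generators `x` (index `0`) and `y` (index `1`). -/
noncomputable def gen (s : Fin 2) : QPoly q := mk q (ι ℤ s)

/-- The monomial `x ^ i * y ^ j`. -/
noncomputable def mon (i j : ℕ) : QPoly q := gen q 0 ^ i * gen q 1 ^ j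

theorem gen_one_mul_gen_zero : gen q 1 * gen q 0 = q * (gen q 0 * gen q 1) := by
  have h : mk q _ = mk q _ := RingQuot.mkAlgHom_rel ℤ (s := qRel q) ⟨rfl, rfl⟩
  rw [zsmul_eq_mul, map_mul, map_mul, map_mul, map_intCast] at h
  exact h

theorem gen_one_pow_mul_gen_zero (b : ℕ) :
    gen q 1 ^ b * gen q 0 = (q : QPoly q) ^ b * (gen q 0 * gen q 1 ^ b) := by
  induction b with
  | zero => simp
  | succ b ih =>
    rw [pow_succ', mul_assoc, ih, ← mul_assoc, ← ((Int.cast_commute q (gen q 1)).pow_left b).eq,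
      mul_assoc, ← mul_assoc (gen q 1), gen_one_mul_gen_zero]
    simp only [pow_succ, mul_assoc]

theorem gen_one_pow_mul_gen_zero_pow (b c : ℕ) :
    gen q 1 ^ b * gen q 0 ^ c = (q : QPoly q) ^ (b * c) * (gen q 0 ^ c * gen q 1 ^ b) := by
  induction c with
  | zero => simp
  | succ c ih =>
    rw [pow_succ, ← mul_assoc, ih, mul_assoc, mul_assoc, gen_one_pow_mul_gen_zero,
      ← mul_assoc (gen q 0 ^ c), ← ((Int.cast_commute q (gen q 0 ^ c)).pow_left b).eq]
    simp only [Nat.mul_succ, pow_add, mul_assoc]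

theorem mon_mul_mon (a b c d : ℕ) :
    mon q a b * mon q c d = q ^ (b * c) • mon q (a + c) (b + d) := by
  rw [mon, mon, mul_assoc, ← mul_assoc (gen q 1 ^ b), gen_one_pow_mul_gen_zero_pow, zsmul_eq_mul,
    ← mul_assoc, ← mul_assoc, ← ((Int.cast_commute q (gen q 0 ^ a)).pow_left (b * c)).eq, mon]
  push_cast
  simp only [pow_add, mul_assoc]

theorem mon_commutator (a b c d : ℕ) :
    mon q a b * mon q c d - mon q c d * mon q a b =
      (q ^ (b * c) - q ^ (a * d)) • mon q (a + c) (b + d) := by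
  rw [mon_mul_mon, mon_mul_mon, sub_smul, add_comm c, add_comm d, mul_comm d]

/-- The image of a word is a multiple of the monomial with the same letter counts. -/
theorem exists_mk_word (w : List (Fin 2)) :
    ∃ n : ℤ, mk q (w.map (ι ℤ)).prod =
      n • mon q (w.count 0) (w.count 1) := by
  induction w with
  | nil => exact ⟨1, by simp [mon]⟩
  | cons s w ih =>
    obtain ⟨n, hn⟩ := ih
    rw [List.map_cons, List.prod_cons, map_mul, hn]
    have h0 : gen q 0 = mon q 1 0 := by simp [mon]
    have h1 : gen q 1 = mon q 0 1 := by simp [mon]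
    fin_cases s
    · refine ⟨n, ?_⟩
      change gen q 0 * n • mon q _ _ = _
      rw [mul_smul_comm, h0, mon_mul_mon]
      simp [add_comm]
    · refine ⟨n * q ^ w.count 0, ?_⟩
      change gen q 1 * n • mon q _ _ = _
      rw [mul_smul_comm, h1, mon_mul_mon]
      simp [add_comm, mul_smul]

theorem mem_qDeg {i j : ℕ} {r : QPoly q} : r ∈ qDeg q i j ↔ ∃ n : ℤ, n • mon q i j = r := by
  constructor
  · rintro ⟨t, ht, rfl⟩
    change ∃ n : ℤ, n • mon q i j = mk q t
    induction ht using Submodule.span_induction with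
    | mem t ht =>
      obtain ⟨w, rfl, rfl, rfl⟩ := ht
      exact (exists_mk_word q w).imp fun _ h ↦ h.symm
    | zero => exact ⟨0, by simp⟩
    | add s t _ _ hs ht =>
      obtain ⟨⟨m, hm⟩, n, hn⟩ := hs, ht
      exact ⟨m + n, by rw [add_smul, hm, hn, map_add]⟩
    | smul c t _ ht =>
      obtain ⟨n, hn⟩ := ht
      exact ⟨c * n, by rw [mul_smul, hn, map_zsmul]⟩
  · rintro ⟨n, rfl⟩
    refine (qDeg q i j).smul_mem n ⟨ι ℤ 0 ^ i * ι ℤ 1 ^ j, Submodule.subset_span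
      ⟨List.replicate i 0 ++ List.replicate j 1, ?_, ?_, ?_⟩, ?_⟩
    · simp [List.count_replicate]
    · simp [List.count_replicate]
    · simp
    · change mk q _ = _
      simp [mon, gen]

/-- The lattice of elements whose coefficient at `x ^ i * y ^ j` is a multiple of `D i j`. -/
noncomputable def lattice (D : ℕ → ℕ → ℤ) : Submodule ℤ (QPoly q) :=
  Submodule.span ℤ (Set.range fun p : ℕ × ℕ ↦ D p.1 p.2 • mon q p.1 p.2)

theorem lattice_le_iff {D : ℕ → ℕ → ℤ} {N : Submodule ℤ (QPoly q)} :
    lattice q D ≤ N ↔ ∀ i j, D i j • mon q i j ∈ N := by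
  simp [lattice, Submodule.span_le, Set.range_subset_iff]

theorem smul_mon_mem_lattice_of_dvd {D : ℕ → ℕ → ℤ} {n : ℤ} {i j : ℕ} (h : D i j ∣ n) :
    n • mon q i j ∈ lattice q D := by
  obtain ⟨k, rfl⟩ := h
  rw [mul_comm, mul_smul]
  exact Submodule.smul_mem _ _ (Submodule.subset_span ⟨(i, j), rfl⟩)

theorem mul_mem_lattice_one {r s : QPoly q} (hr : r ∈ lattice q fun _ _ ↦ 1)
    (hs : s ∈ lattice q fun _ _ ↦ 1) : r * s ∈ lattice q fun _ _ ↦ 1 := by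
  induction hr, hs using Submodule.span_induction₂ with
  | mem_mem r s hr hs =>
    obtain ⟨⟨⟨a, b⟩, rfl⟩, ⟨c, d⟩, rfl⟩ := hr, hs
    simp only [one_smul, mon_mul_mon]
    exact smul_mon_mem_lattice_of_dvd q (one_dvd _)
  | zero_left s _ => simp
  | zero_right r _ => simp
  | add_left r s t _ _ _ h h' => rw [add_mul]; exact add_mem h h'
  | add_right r s t _ _ _ h h' => rw [mul_add]; exact add_mem h h'
  | smul_left n r s _ _ h => rw [smul_mul_assoc]; exact Submodule.smul_mem _ n h
  | smul_right n r s _ _ h => rw [mul_smul_comm]; exact Submodule.smul_mem _ n h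

theorem mem_lattice_one (r : QPoly q) : r ∈ lattice q fun _ _ ↦ 1 := by
  have hmon (i j : ℕ) : mon q i j ∈ lattice q fun _ _ ↦ 1 := by
    rw [← one_smul ℤ (mon q i j)]
    exact smul_mon_mem_lattice_of_dvd q dvd_rfl
  obtain ⟨t, rfl⟩ : ∃ t, mk q t = r := RingQuot.mkAlgHom_surjective ℤ (qRel q) r
  induction t with
  | grade0 n =>
    have : mk q (algebraMap ℤ _ n) = n • mon q 0 0 := by simp [mon]
    rw [this]
    exact smul_mon_mem_lattice_of_dvd q (one_dvd _)
  | grade1 s =>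
    fin_cases s
    · simpa [mon, gen] using hmon 1 0
    · simpa [mon, gen] using hmon 0 1
  | mul s t hs ht => rw [map_mul]; exact mul_mem_lattice_one q hs ht
  | add s t hs ht => rw [map_add]; exact add_mem hs ht

theorem commutator_mem_lattice {D E : ℕ → ℕ → ℤ}
    (h : ∀ a b c d, E (a + c) (b + d) ∣ D c d * (q ^ (b * c) - q ^ (a * d)))
    (r : QPoly q) {s : QPoly q} (hs : s ∈ lattice q D) : r * s - s * r ∈ lattice q E := by
  have hr := mem_lattice_one q r
  induction hr, hs using Submodule.span_induction₂ with
  | mem_mem r s hr hs =>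
    obtain ⟨⟨⟨a, b⟩, rfl⟩, ⟨c, d⟩, rfl⟩ := hr, hs
    simp only [one_smul]
    rw [mul_smul_comm, smul_mul_assoc, ← smul_sub, mon_commutator, ← mul_smul]
    exact smul_mon_mem_lattice_of_dvd q (h a b c d)
  | zero_left s _ => simp
  | zero_right r _ => simp
  | add_left r s t _ _ _ h h' => rw [add_mul, mul_add, add_sub_add_comm]; exact add_mem h h'
  | add_right r s t _ _ _ h h' => rw [add_mul, mul_add, add_sub_add_comm]; exact add_mem h h'
  | smul_left n r s _ _ h =>
    rw [smul_mul_assoc, mul_smul_comm, ← smul_sub]; exact Submodule.smul_mem _ n h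
  | smul_right n r s _ _ h =>
    rw [smul_mul_assoc, mul_smul_comm, ← smul_sub]; exact Submodule.smul_mem _ n h

/-- The operators by which `x` (a shift) and `y` (a scaled shift) act on the free module on
monomials. -/
noncomputable def actGen : Fin 2 → Module.End ℤ (ℕ × ℕ →₀ ℤ) :=
  ![Finsupp.lmapDomain ℤ ℤ fun p ↦ (p.1 + 1, p.2),
    Finsupp.linearCombination ℤ fun p ↦ Finsupp.single (p.1, p.2 + 1) (q ^ p.1)]

/-- The representation of the q-polynomial algebra on the free module on monomials. -/
noncomputable def act : QPoly q →ₐ[ℤ] Module.End ℤ (ℕ × ℕ →₀ ℤ) :=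
  RingQuot.liftAlgHom ℤ ⟨FreeAlgebra.lift ℤ (actGen q), by
    rintro _ _ ⟨rfl, rfl⟩
    refine Finsupp.lhom_ext' fun p ↦ LinearMap.ext_ring ?_
    simp [actGen, pow_succ']⟩

theorem act_gen (s : Fin 2) : act q (gen q s) = actGen q s := by
  change RingQuot.liftAlgHom ℤ _ (RingQuot.mkAlgHom ℤ (qRel q) (ι ℤ s)) = _
  rw [RingQuot.liftAlgHom_mkAlgHom_apply, FreeAlgebra.lift_ι_apply]

theorem act_mon (i j : ℕ) : act q (mon q i j) (Finsupp.single (0, 0) 1) =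
    Finsupp.single (i, j) 1 := by
  have hy : ∀ j, (actGen q 1 ^ j) (Finsupp.single (0, 0) 1) = Finsupp.single (0, j) 1 := by
    intro j
    induction j with
    | zero => simp
    | succ j ih => rw [pow_succ', Module.End.mul_apply, ih]; simp [actGen]
  rw [mon, map_mul, map_pow, map_pow, act_gen, act_gen, Module.End.mul_apply, hy]
  induction i with
  | zero => simp
  | succ i ih => rw [pow_succ', Module.End.mul_apply, ih]; simp [actGen]

/-- The coefficient of `x ^ i * y ^ j`. -/
noncomputable def coeff (i j : ℕ) : QPoly q →+ ℤ :=
  (Finsupp.applyAddHom (i, j)).comp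
    ((LinearMap.applyₗ (R := ℤ) (M₂ := ℕ × ℕ →₀ ℤ)
      (Finsupp.single (0, 0) (1 : ℤ))).toAddMonoidHom.comp (act q : QPoly q →+ _))

theorem coeff_mon (i j a b : ℕ) : coeff q i j (mon q a b) = if a = i ∧ b = j then 1 else 0 := by
  change act q (mon q a b) (Finsupp.single (0, 0) 1) (i, j) = _
  rw [act_mon, Finsupp.single_apply]
  simp

theorem dvd_coeff_of_mem_lattice {D : ℕ → ℕ → ℤ} {r : QPoly q} (hr : r ∈ lattice q D) (i j : ℕ) :
    D i j ∣ coeff q i j r := by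
  induction hr using Submodule.span_induction with
  | mem r hr =>
    obtain ⟨⟨a, b⟩, rfl⟩ := hr
    rw [map_zsmul, coeff_mon]
    split_ifs with h
    · obtain ⟨rfl, rfl⟩ := h
      simp
    · simp
  | zero => simp
  | add r s _ _ hr hs => rw [map_add]; exact dvd_add hr hs
  | smul n r _ hr => rw [map_zsmul]; exact hr.mul_left n

theorem smul_mon_mem_lattice {D : ℕ → ℕ → ℤ} {n : ℤ} {i j : ℕ} :
    n • mon q i j ∈ lattice q D ↔ D i j ∣ n :=
  ⟨fun h ↦ by
    simpa only [map_zsmul, coeff_mon, and_self, if_true, smul_eq_mul, mul_one] using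
      dvd_coeff_of_mem_lattice q h i j,
    smul_mon_mem_lattice_of_dvd q⟩

/-- The generator of the coefficients of `L₂` in degree `(i, j)`. -/
def genTwo (i j : ℕ) : ℤ := if i = 0 ∨ j = 0 then 0 else q ^ i.gcd j - 1

/-- The generator of the coefficients of `L₃` in degree `(i, j)`. -/
def genThree (i j : ℕ) : ℤ := if i = 1 ∧ j = 1 then 0 else (q - 1) * genTwo q i j

theorem genTwo_dvd (a b c d : ℕ) : genTwo q (a + c) (b + d) ∣ q ^ (b * c) - q ^ (a * d) := by
  rw [genTwo]
  split_ifs with h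
  · obtain h | h := h <;> obtain ⟨rfl, rfl⟩ := Nat.add_eq_zero_iff.1 h <;> simp
  · apply sub_one_pow_dvd_pow_sub_pow
    apply Nat.ModEq.add_right_cancel' (a * b)
    have h1 : b * c + a * b ≡ 0 [MOD (a + c).gcd (b + d)] :=
      Nat.modEq_zero_iff_dvd.2 ((Nat.gcd_dvd_left _ _).trans ⟨b, by ring⟩)
    have h2 : a * d + a * b ≡ 0 [MOD (a + c).gcd (b + d)] :=
      Nat.modEq_zero_iff_dvd.2 ((Nat.gcd_dvd_right _ _).trans ⟨a, by ring⟩)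
    exact h1.trans h2.symm

theorem sub_one_dvd_genTwo (i j : ℕ) : q - 1 ∣ genTwo q i j := by
  rw [genTwo]
  split_ifs
  · simp
  · exact sub_one_dvd_pow_sub_one q _

theorem genThree_dvd (a b c d : ℕ) :
    genThree q (a + c) (b + d) ∣ genTwo q c d * (q ^ (b * c) - q ^ (a * d)) := by
  rw [genThree]
  split_ifs with h
  · by_cases hcd : c = 0 ∨ d = 0
    · simp [genTwo, hcd]
    · obtain ⟨rfl, rfl⟩ : a = 0 ∧ b = 0 := by omega
      simp
  · exact mul_dvd_mul (sub_one_dvd_genTwo q c d) (genTwo_dvd q a b c d)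

theorem commutator_mem_lcs {k : ℕ} (r : QPoly q) {s : QPoly q} (hs : s ∈ lcs q (k + 1)) :
    r * s - s * r ∈ lcs q (k + 2) :=
  Submodule.subset_span ⟨r, s, hs, rfl⟩

theorem smul_mon_mem_lcs_left {k : ℕ} {n : ℤ} {i j : ℕ} (hi : 0 < i)
    (h : n • mon q (i - 1) j ∈ lcs q (k + 1)) :
    (n * (q ^ j - 1)) • mon q i j ∈ lcs q (k + 2) := by
  have := neg_mem (commutator_mem_lcs q (mon q 1 0) h)
  rwa [mul_smul_comm, smul_mul_assoc, ← smul_sub, mon_commutator, ← smul_neg,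
    ← neg_smul, ← mul_smul, Nat.add_sub_cancel' hi, zero_add, zero_mul, one_mul,
    pow_zero, neg_sub] at this

theorem smul_mon_mem_lcs_right {k : ℕ} {n : ℤ} {i j : ℕ} (hj : 0 < j)
    (h : n • mon q i (j - 1) ∈ lcs q (k + 1)) :
    (n * (q ^ i - 1)) • mon q i j ∈ lcs q (k + 2) := by
  have := commutator_mem_lcs q (mon q 0 1) h
  rwa [mul_smul_comm, smul_mul_assoc, ← smul_sub, mon_commutator, ← mul_smul,
    Nat.add_sub_cancel' hj, zero_add, zero_mul, one_mul, pow_zero] at this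

theorem lcs_two : lcs q 2 = lattice q (genTwo q) := by
  apply le_antisymm
  · refine Submodule.span_le.2 ?_
    rintro _ ⟨r, s, -, rfl⟩
    exact commutator_mem_lattice q (fun a b c d ↦ by simpa using genTwo_dvd q a b c d) r
      (mem_lattice_one q s)
  · rw [lattice_le_iff]
    intro i j
    rw [genTwo]
    split_ifs with h
    · simp
    · obtain ⟨u, v, huv⟩ := exists_pow_gcd_sub_one q i j
      rw [← huv, add_smul, mul_smul, mul_smul]
      refine add_mem (Submodule.smul_mem _ _ ?_) (Submodule.smul_mem _ _ ?_)
      · simpa using smul_mon_mem_lcs_right q (k := 0) (n := 1) (i := i) (j := j) (by omega) trivial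
      · simpa using smul_mon_mem_lcs_left q (k := 0) (n := 1) (i := i) (j := j) (by omega) trivial

variable {q}

theorem lcs_three (hq : q ≠ 1) (hq' : q ≠ -1) : lcs q 3 = lattice q (genThree q) := by
  apply le_antisymm
  · refine Submodule.span_le.2 ?_
    rintro _ ⟨r, s, hs, rfl⟩
    rw [lcs_two] at hs
    exact commutator_mem_lattice q (genThree_dvd q) r hs
  · have mem {i j : ℕ} (hi : i ≠ 0) (hj : j ≠ 0) : (q ^ i.gcd j - 1) • mon q i j ∈ lcs q 2 := by
      rw [lcs_two, smul_mon_mem_lattice, genTwo, if_neg (by simp [hi, hj])]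
    rw [lattice_le_iff]
    intro i j
    rw [genThree, genTwo]
    split_ifs with h1 h0
    · simp
    · simp
    · obtain ⟨hi0, hj0⟩ := not_or.1 h0
      obtain rfl | hi := eq_or_ne i 1
      · have hj : j - 1 ≠ 0 := by omega
        simpa using smul_mon_mem_lcs_right q (by omega) (mem one_ne_zero hj)
      obtain rfl | hj := eq_or_ne j 1
      · have hi : i - 1 ≠ 0 := by omega
        simpa using smul_mon_mem_lcs_left q (by omega) (mem hi one_ne_zero)
      · obtain ⟨u, v, huv⟩ := exists_bezout_sub_one_mul hq hq' (i := i) (j := j)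
          (by omega) (by omega)
        rw [← huv, add_smul, mul_smul u, mul_smul v]
        refine add_mem (Submodule.smul_mem _ _ ?_) (Submodule.smul_mem _ _ ?_)
        · exact smul_mon_mem_lcs_left q (by omega) (mem (by omega) hj0)
        · exact smul_mon_mem_lcs_right q (by omega) (mem hi0 (by omega))

/-- The map from `ℤ` onto the degree-`(i, j)` component of `B₂` given by the generator of the
degree-`(i, j)` component of `L₂`. -/
noncomputable def toB2comp (q : ℤ) (i j : ℕ) : ℤ →+ B2comp q i j :=
  zmultiplesHom _ (Submodule.Quotient.mk ⟨genTwo q i j • mon q i j, by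
    rw [lcs_two]
    exact ⟨(smul_mon_mem_lattice q).2 dvd_rfl, (mem_qDeg q).2 ⟨_, rfl⟩⟩⟩)

theorem toB2comp_surjective (q : ℤ) (i j : ℕ) : Function.Surjective (toB2comp q i j) := by
  intro z
  obtain ⟨⟨r, hr, hr'⟩, rfl⟩ := Submodule.Quotient.mk_surjective _ z
  obtain ⟨n, rfl⟩ := (mem_qDeg q).1 hr'
  rw [lcs_two] at hr
  obtain ⟨k, rfl⟩ := (smul_mon_mem_lattice q).1 hr
  refine ⟨k, ?_⟩
  rw [toB2comp, zmultiplesHom_apply, ← Submodule.Quotient.mk_smul]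
  congr 1
  ext
  simp [mul_comm, mul_smul]

theorem mem_ker_toB2comp (hq : q ≠ 1) (hq' : q ≠ -1) {i j : ℕ} {n : ℤ} :
    n ∈ (toB2comp q i j).ker ↔ genThree q i j ∣ n * genTwo q i j := by
  rw [AddMonoidHom.mem_ker, toB2comp, zmultiplesHom_apply, ← Submodule.Quotient.mk_smul,
    Submodule.Quotient.mk_eq_zero, Submodule.mem_comap, ← smul_mon_mem_lattice q,
    ← lcs_three hq hq', mul_smul]
  rfl

theorem genTwo_ne_zero (hq : q ≠ 1) (hq' : q ≠ -1) {i j : ℕ} (hi : 0 < i) (hj : 0 < j) :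
    genTwo q i j ≠ 0 := by
  rw [genTwo, if_neg (by omega)]
  exact pow_sub_one_ne_zero hq hq' (Nat.gcd_pos_of_pos_left j hi).ne'

end QPoly

/-- For `A = ℤ⟨x,y⟩/(yx - qxy)` with `q ≠ ±1`, the bigraded pieces of
`B₂(A) = L₂(A)/L₃(A)` are `ℤ/(q-1)` for `i,j > 0`, `i+j > 2`, `ℤ` for
`i = j = 1`, and `0` when `i = 0` or `j = 0`. -/
theorem stmt_3 (q : ℤ) (hq : q ≠ 1) (hq' : q ≠ -1) (i j : ℕ) :
    (0 < i → 0 < j → 2 < i + j →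
      Nonempty (B2comp q i j ≃+ ZMod (q - 1).natAbs)) ∧
    (i = 1 → j = 1 → Nonempty (B2comp q i j ≃+ ℤ)) ∧
    (i = 0 ∨ j = 0 → Subsingleton (B2comp q i j)) := by
  refine ⟨fun hi hj hij ↦ ?_, ?_, fun h ↦ ?_⟩
  · have hker : (QPoly.toB2comp q i j).ker = AddSubgroup.zmultiples (q - 1) := by
      ext n
      rw [QPoly.mem_ker_toB2comp hq hq', QPoly.genThree, if_neg (by omega),
        mul_dvd_mul_iff_right (QPoly.genTwo_ne_zero hq hq' hi hj), Int.mem_zmultiples_iff]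
    exact ⟨(QuotientAddGroup.quotientKerEquivOfSurjective _
      (QPoly.toB2comp_surjective q i j)).symm.trans
      ((QuotientAddGroup.quotientAddEquivOfEq hker).trans (Int.quotientZMultiplesEquivZMod _))⟩
  · rintro rfl rfl
    refine ⟨(AddEquiv.ofBijective (QPoly.toB2comp q 1 1)
      ⟨(AddMonoidHom.ker_eq_bot_iff _).1 ?_, QPoly.toB2comp_surjective q 1 1⟩).symm⟩
    ext n
    have := QPoly.genTwo_ne_zero hq hq' one_pos one_pos
    rw [QPoly.mem_ker_toB2comp hq hq']
    simp [QPoly.genThree, this]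
  · have hker (n : ℤ) : QPoly.toB2comp q i j n = 0 := by
      rw [← AddMonoidHom.mem_ker, QPoly.mem_ker_toB2comp hq hq', QPoly.genTwo, if_pos h]
      simp
    refine ⟨fun a b ↦ ?_⟩
    obtain ⟨m, rfl⟩ := QPoly.toB2comp_surjective q i j a
    obtain ⟨n, rfl⟩ := QPoly.toB2comp_surjective q i j b
    rw [hker, hker]
end

section
/- Let f ∈ ℂ[x,y] be a homogeneous polynomial of degree m ≥ 2 whose abelianization has s distinct linear factors over ℂ. Then the Hilbert function of the quotient ring ℂ[x,y]/(f_x, f_y), where f_x = ∂f/∂x, f_y = ∂f/∂y, satisfies: dim (ℂ[x,y]/(f_x,f_y))[d] = d+1 for 0 ≤ d ≤ m-2, = 2m-3-d for m-1 ≤ d ≤ m+s-3, and = m-s for d ≥ m+s-2. -/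
open MvPolynomial

/-- The degree-`d` component of `ℂ[x,y]/(f_x, f_y)`: the image of the
homogeneous degree-`d` polynomials in the quotient module. -/
noncomputable def quotComponent (f : MvPolynomial (Fin 2) ℂ) (d : ℕ) :
    Submodule ℂ
      (MvPolynomial (Fin 2) ℂ ⧸
        (Ideal.span {pderiv 0 f, pderiv 1 f} :
          Submodule (MvPolynomial (Fin 2) ℂ) (MvPolynomial (Fin 2) ℂ))) :=
  Submodule.map
    ((Ideal.span {pderiv 0 f, pderiv 1 f}).mkQ.restrictScalars ℂ)
    (homogeneousSubmodule (Fin 2) ℂ d)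

section Helpers

variable {K : Type*} [Field K]

instance homogeneousSubmodule_finiteDimensional {σ : Type*} [Finite σ] (n : ℕ) :
    FiniteDimensional K (homogeneousSubmodule σ K n) :=
  Module.Finite.iff_fg.mpr (homogeneousSubmodule_fg σ K n)

theorem finrank_homogeneousSubmodule_fin_two (n : ℕ) :
    Module.finrank K (homogeneousSubmodule (Fin 2) K n) = n + 1 := by
  have hcard : Nat.card {d : Fin 2 →₀ ℕ | d.degree = n} = n + 1 := by
    have hset : {d : Fin 2 →₀ ℕ | d.degree = n} =
        ((Finset.univ : Finset (Fin 2)).finsuppAntidiag n : Set (Fin 2 →₀ ℕ)) := by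
      ext d
      simp [Finsupp.degree_eq_sum]
    rw [hset, Nat.card_coe_set_eq, Set.ncard_coe_finset, Finset.card_finsuppAntidiag_nat_eq_choose]
    simp [add_comm 1 n]
  have hfin : Finite {d : Fin 2 →₀ ℕ | d.degree = n} :=
    Nat.finite_of_card_ne_zero (by omega)
  have := Fintype.ofFinite {d : Fin 2 →₀ ℕ | d.degree = n}
  rw [homogeneousSubmodule_eq_finsupp_supported]
  rw [(AddMonoidAlgebra.supportedEquivFinsupp (R := K) (S := K) _).finrank_eq,
    Module.finrank_finsupp_self, ← Nat.card_eq_fintype_card, hcard]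

theorem homogeneousComponent_homogeneous_mul {σ : Type*} {a : MvPolynomial σ K} {k : ℕ}
    (ha : a.IsHomogeneous k) (p : MvPolynomial σ K) (n : ℕ) :
    homogeneousComponent (k + n) (a * p) = a * homogeneousComponent n p := by
  let _ := gradedAlgebra (σ := σ) (R := K)
  have := DirectSum.coe_decompose_mul_add_of_left_mem (homogeneousSubmodule σ K) (i := k)
    (j := n) (a := a) (b := p) ha
  rwa [← DirectSum.Decomposition.decompose'_eq, decomposition.decompose'_apply,
    decomposition.decompose'_apply] at this

theorem homogeneousComponent_homogeneous_mul_of_lt {σ : Type*} {a : MvPolynomial σ K} {k n : ℕ}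
    (ha : a.IsHomogeneous k) (p : MvPolynomial σ K) (hn : n < k) :
    homogeneousComponent n (a * p) = 0 := by
  let _ := gradedAlgebra (σ := σ) (R := K)
  have := DirectSum.coe_decompose_mul_of_left_mem_of_not_le (homogeneousSubmodule σ K) (i := k)
    (n := n) (a := a) (b := p) ha (by omega)
  rwa [← DirectSum.Decomposition.decompose'_eq, decomposition.decompose'_apply] at this

theorem IsRelPrime.exists_eq_mul_of_mul_add_mul_eq_zero {R : Type*} [CommRing R] [IsDomain R]
    [DecompositionMonoid R] {a b u v : R} (hab : IsRelPrime a b) (h : a * u + b * v = 0) :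
    ∃ w, u = -(b * w) ∧ v = a * w := by
  by_cases ha : a = 0
  · subst ha
    have hb : IsUnit b := isRelPrime_zero_left.mp hab
    obtain ⟨c, rfl⟩ := hb
    refine ⟨-(↑c⁻¹ * u), by simp, ?_⟩
    simpa using h
  · have hdvd : a ∣ b * v := ⟨-u, by linear_combination h⟩
    obtain ⟨w, rfl⟩ := hab.dvd_of_dvd_mul_left hdvd
    exact ⟨w, mul_left_cancel₀ ha (by linear_combination h), rfl⟩

/-- The map `(u, v) ↦ F u + G v` on pairs of forms of degree `n`. -/
noncomputable def formCombination {σ : Type*} (F G : MvPolynomial σ K) (n : ℕ) :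
    (homogeneousSubmodule σ K n × homogeneousSubmodule σ K n) →ₗ[K] MvPolynomial σ K :=
  ((LinearMap.mulLeft K F).comp (homogeneousSubmodule σ K n).subtype).coprod
    ((LinearMap.mulLeft K G).comp (homogeneousSubmodule σ K n).subtype)

theorem formCombination_apply {σ : Type*} (F G : MvPolynomial σ K) (n : ℕ)
    (p : homogeneousSubmodule σ K n × homogeneousSubmodule σ K n) :
    formCombination F G n p = F * p.1 + G * p.2 := rfl

theorem range_formCombination {σ : Type*} {F G : MvPolynomial σ K} {e : ℕ}
    (hF : F.IsHomogeneous e) (hG : G.IsHomogeneous e) (n : ℕ) :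
    LinearMap.range (formCombination F G n) =
      homogeneousSubmodule σ K (e + n) ⊓ (Ideal.span {F, G}).restrictScalars K := by
  ext p
  simp only [LinearMap.mem_range, formCombination_apply, Submodule.mem_inf,
    Submodule.restrictScalars_mem, Ideal.mem_span_pair, mem_homogeneousSubmodule]
  constructor
  · rintro ⟨⟨⟨u, hu⟩, ⟨v, hv⟩⟩, rfl⟩
    exact ⟨(hF.mul hu).add (hG.mul hv), u, v, by ring⟩
  · rintro ⟨hp, u, v, rfl⟩
    refine ⟨⟨⟨_, homogeneousComponent_mem n u⟩, ⟨_, homogeneousComponent_mem n v⟩⟩, ?_⟩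
    rw [← homogeneousComponent_eq_self hp, map_add, mul_comm u, mul_comm v,
      homogeneousComponent_homogeneous_mul hF, homogeneousComponent_homogeneous_mul hG]

theorem homogeneousSubmodule_inf_span_pair_of_lt {σ : Type*} {F G : MvPolynomial σ K} {e d : ℕ}
    (hF : F.IsHomogeneous e) (hG : G.IsHomogeneous e) (hd : d < e) :
    homogeneousSubmodule σ K d ⊓ (Ideal.span {F, G}).restrictScalars K = ⊥ := by
  rw [eq_bot_iff]
  rintro p ⟨hp, hI⟩
  obtain ⟨u, v, rfl⟩ := Ideal.mem_span_pair.mp hI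
  rw [Submodule.mem_bot, ← homogeneousComponent_eq_self hp, map_add, mul_comm u, mul_comm v,
    homogeneousComponent_homogeneous_mul_of_lt hF _ hd,
    homogeneousComponent_homogeneous_mul_of_lt hG _ hd, add_zero]

theorem ker_formCombination_eq_bot {σ : Type*} {g a b : MvPolynomial σ K} {k n : ℕ} (hg : g ≠ 0)
    (ha : a.IsHomogeneous k) (hb : b.IsHomogeneous k) (hab : IsRelPrime a b) (hn : n < k) :
    LinearMap.ker (formCombination (g * a) (g * b) n) = ⊥ := by
  rw [eq_bot_iff]
  rintro ⟨⟨u, hu⟩, ⟨v, hv⟩⟩ h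
  rw [LinearMap.mem_ker, formCombination_apply] at h
  obtain ⟨w, rfl, rfl⟩ := hab.exists_eq_mul_of_mul_add_mul_eq_zero (u := u) (v := v)
    (mul_left_cancel₀ hg (by linear_combination h))
  have h1 : -(b * w) = 0 := by
    rw [← homogeneousComponent_eq_self hu, map_neg,
      homogeneousComponent_homogeneous_mul_of_lt hb _ hn, neg_zero]
  have h2 : a * w = 0 := by
    rw [← homogeneousComponent_eq_self hv, homogeneousComponent_homogeneous_mul_of_lt ha _ hn]
  simp [h1, h2]

theorem finrank_ker_formCombination {σ : Type*} {g a b : MvPolynomial σ K} {k : ℕ} (hg : g ≠ 0)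
    (ha : a.IsHomogeneous k) (hb : b.IsHomogeneous k) (hab : IsRelPrime a b) (n : ℕ) :
    Module.finrank K (LinearMap.ker (formCombination (g * a) (g * b) (k + n))) =
      Module.finrank K (homogeneousSubmodule σ K n) := by
  let ψ : homogeneousSubmodule σ K n →ₗ[K]
      homogeneousSubmodule σ K (k + n) × homogeneousSubmodule σ K (k + n) :=
    (LinearMap.codRestrict _ ((LinearMap.mulLeft K (-b)).comp (Submodule.subtype _))
      fun w => hb.neg.mul w.2).prod
    (LinearMap.codRestrict _ ((LinearMap.mulLeft K a).comp (Submodule.subtype _))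
      fun w => ha.mul w.2)
  have hψ : Function.Injective ψ := by
    intro w w' h
    have h1 : -b * (w : MvPolynomial σ K) = -b * w' :=
      congrArg (fun p => (p.1 : MvPolynomial σ K)) h
    have h2 : a * (w : MvPolynomial σ K) = a * w' :=
      congrArg (fun p => (p.2 : MvPolynomial σ K)) h
    by_cases ha0 : a = 0
    · subst ha0
      exact Subtype.ext (mul_left_cancel₀ (neg_ne_zero.mpr (isRelPrime_zero_left.mp hab).ne_zero) h1)
    · exact Subtype.ext (mul_left_cancel₀ ha0 h2)
  have hrange : LinearMap.ker (formCombination (g * a) (g * b) (k + n)) = LinearMap.range ψ := by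
    ext ⟨⟨u, hu⟩, ⟨v, hv⟩⟩
    rw [LinearMap.mem_ker, formCombination_apply]
    constructor
    · intro h
      obtain ⟨w, rfl, rfl⟩ := hab.exists_eq_mul_of_mul_add_mul_eq_zero (u := u) (v := v)
        (mul_left_cancel₀ hg (by linear_combination h))
      refine ⟨⟨_, homogeneousComponent_mem n w⟩, ?_⟩
      refine Prod.ext (Subtype.ext ?_) (Subtype.ext ?_)
      · change -b * homogeneousComponent n w = -(b * w)
        rw [neg_mul, ← homogeneousComponent_homogeneous_mul hb, ← map_neg,
          homogeneousComponent_eq_self hu]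
      · change a * homogeneousComponent n w = a * w
        rw [← homogeneousComponent_homogeneous_mul ha, homogeneousComponent_eq_self hv]
    · rintro ⟨w, h⟩
      have h1 : -b * (w : MvPolynomial σ K) = u := congrArg (fun p => (p.1 : MvPolynomial σ K)) h
      have h2 : a * (w : MvPolynomial σ K) = v := congrArg (fun p => (p.2 : MvPolynomial σ K)) h
      simp only [← h1, ← h2]
      ring
  rw [hrange, LinearMap.finrank_range_of_inj hψ]

/-- The degree `d` part of the quotient and the degree `d` part of the ideal have complementary
dimensions. -/
theorem finrank_map_mkQ_add_finrank_inf {σ : Type*} [Finite σ] (I : Ideal (MvPolynomial σ K))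
    (d : ℕ) :
    Module.finrank K (Submodule.map (I.mkQ.restrictScalars K) (homogeneousSubmodule σ K d)) +
      Module.finrank K ↥(homogeneousSubmodule σ K d ⊓ I.restrictScalars K) =
      Module.finrank K (homogeneousSubmodule σ K d) := by
  have h := LinearMap.finrank_range_add_finrank_ker
    ((I.mkQ.restrictScalars K).domRestrict (homogeneousSubmodule σ K d))
  rw [LinearMap.range_domRestrict, LinearMap.ker_domRestrict] at h
  rw [← h, ← Submodule.map_comap_subtype, Submodule.finrank_map_subtype_eq]
  have hker : LinearMap.ker (I.mkQ.restrictScalars K) = I.restrictScalars K := by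
    rw [LinearMap.ker_restrictScalars, Submodule.ker_mkQ]
  rw [hker]

/-- The linear form `α x + β y`. -/
noncomputable def linearForm (α β : K) : MvPolynomial (Fin 2) K := C α * X 0 + C β * X 1

theorem linearForm_isHomogeneous (α β : K) : (linearForm α β).IsHomogeneous 1 :=
  (isHomogeneous_C_mul_X _ _).add (isHomogeneous_C_mul_X _ _)

theorem eval_linearForm (α β : K) (P : Fin 2 → K) :
    eval P (linearForm α β) = α * P 0 + β * P 1 := by
  simp [linearForm]

theorem linearForm_ne_zero {α β : K} (h : (α, β) ≠ 0) : linearForm α β ≠ 0 := by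
  intro h0
  apply h
  have h1 := congrArg (eval ![1, 0]) h0
  have h2 := congrArg (eval ![0, 1]) h0
  simp [eval_linearForm] at h1 h2
  simp [h1, h2]

theorem eval_eq_zero_of_prime_dvd_linearForm {α β : K} (h : (α, β) ≠ 0)
    {p : MvPolynomial (Fin 2) K} (hp : Prime p) (hdvd : p ∣ linearForm α β) :
    eval ![β, -α] p = 0 := by
  obtain ⟨q, hq⟩ := hdvd
  have hl := linearForm_ne_zero h
  have hq0 : q ≠ 0 := by
    rintro rfl
    simp [hq] at hl
  have hdeg := totalDegree_mul_of_isDomain hp.ne_zero hq0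
  rw [← hq, (linearForm_isHomogeneous α β).totalDegree hl] at hdeg
  have hpdeg : p.totalDegree ≠ 0 := by
    intro h0
    rw [totalDegree_eq_zero_iff_eq_C.mp h0] at hp
    refine hp.not_isUnit ((isUnit_iff_ne_zero.mpr ?_).map C)
    intro hc
    simp [hc] at hp
  have hqC := totalDegree_eq_zero_iff_eq_C.mp (show q.totalDegree = 0 by omega)
  have heval := congrArg (eval ![β, -α]) hq
  rw [eval_linearForm, map_mul, hqC, eval_C] at heval
  have hcoeff : coeff 0 q ≠ 0 := by
    intro hc
    exact hq0 (by rw [hqC, hc, C_0])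
  refine (mul_eq_zero.mp (heval.symm.trans ?_)).resolve_right hcoeff
  simp
  ring

section Products

variable {ι : Type*} [Fintype ι] [DecidableEq ι]

/-- For `ℓ i = α i x + β i y`, the form `∑ i, γ i ∏_{j ≠ i} ℓ j`. -/
noncomputable def cofactorSum (α β γ : ι → K) : MvPolynomial (Fin 2) K :=
  ∑ i, C (γ i) * ∏ j ∈ Finset.univ.erase i, linearForm (α j) (β j)

theorem cofactorSum_isHomogeneous (α β γ : ι → K) :
    (cofactorSum α β γ).IsHomogeneous (Fintype.card ι - 1) := by
  refine IsHomogeneous.sum _ _ _ fun i _ => IsHomogeneous.C_mul ?_ _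
  have h := IsHomogeneous.prod (Finset.univ.erase i) (fun j => linearForm (α j) (β j))
    (fun _ => 1) fun j _ => linearForm_isHomogeneous _ _
  simpa [Finset.card_erase_of_mem] using h

theorem eval_cofactorSum (α β γ : ι → K) (i : ι) :
    eval ![β i, -α i] (cofactorSum α β γ) =
      γ i * ∏ j ∈ Finset.univ.erase i, (α j * β i - α i * β j) := by
  rw [cofactorSum, map_sum, Finset.sum_eq_single i]
  · simp only [map_mul, eval_C, map_prod, eval_linearForm]
    congr 1
    refine Finset.prod_congr rfl fun j _ => ?_
    simp
    ring
  · intro j _ hji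
    rw [map_mul, map_prod, Finset.prod_eq_zero (i := i) (by simp [hji.symm]), mul_zero]
    rw [eval_linearForm]
    simp
    ring
  · simp

theorem X_mul_cofactorSum_add (α β γ : ι → K) :
    X 0 * cofactorSum α β (fun i => γ i * α i) + X 1 * cofactorSum α β (fun i => γ i * β i) =
      C (∑ i, γ i) * ∏ i, linearForm (α i) (β i) := by
  simp only [cofactorSum, Finset.mul_sum, ← Finset.sum_add_distrib, map_sum, Finset.sum_mul]
  refine Finset.sum_congr rfl fun i _ => ?_
  rw [← Finset.mul_prod_erase Finset.univ (fun i => linearForm (α i) (β i)) (Finset.mem_univ i),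
    linearForm, C_mul, C_mul]
  ring

theorem isRelPrime_cofactorSum [Nonempty ι] {α β γ : ι → K} (hnz : ∀ i, (α i, β i) ≠ 0)
    (hdist : ∀ i j, i ≠ j → α i * β j ≠ α j * β i) (hγ : ∀ i, γ i ≠ 0) (hsum : ∑ i, γ i ≠ 0) :
    IsRelPrime (cofactorSum α β fun i => γ i * α i) (cofactorSum α β fun i => γ i * β i) := by
  have hvanish : ∀ i, eval ![β i, -α i] (cofactorSum α β fun i => γ i * α i) = 0 →
      eval ![β i, -α i] (cofactorSum α β fun i => γ i * β i) = 0 → False := by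
    intro i h1 h2
    have hprod : ∏ j ∈ Finset.univ.erase i, (α j * β i - α i * β j) ≠ 0 :=
      Finset.prod_ne_zero_iff.mpr fun j hj =>
        sub_ne_zero.mpr (hdist j i (Finset.ne_of_mem_erase hj))
    rw [eval_cofactorSum] at h1 h2
    simp only [mul_eq_zero, hprod, hγ i, false_or, or_false] at h1 h2
    exact hnz i (by simp [h1, h2])
  by_cases ha : cofactorSum α β (fun i => γ i * α i) = 0 ∧
      cofactorSum α β (fun i => γ i * β i) = 0
  · obtain ⟨i⟩ := ‹Nonempty ι›
    exact (hvanish i (by simp [ha.1]) (by simp [ha.2])).elim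
  have hprime : ∀ p, p ∣ cofactorSum α β (fun i => γ i * α i) →
      p ∣ cofactorSum α β (fun i => γ i * β i) → ¬ Prime p := by
    intro p h1 h2 hp
    have hdvd : p ∣ C (∑ i, γ i) * ∏ i, linearForm (α i) (β i) := by
      rw [← X_mul_cofactorSum_add]
      exact dvd_add (h1.mul_left _) (h2.mul_left _)
    have hunit : IsUnit (C (∑ i, γ i) : MvPolynomial (Fin 2) K) :=
      (isUnit_iff_ne_zero.mpr hsum).map C
    obtain ⟨i, -, hi⟩ := (hp.dvd_finsetProd_iff _).mp (hunit.dvd_mul_left.mp hdvd)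
    have h0 := eval_eq_zero_of_prime_dvd_linearForm (hnz i) hp hi
    refine hvanish i ?_ ?_
    · exact zero_dvd_iff.mp (h0 ▸ map_dvd (eval ![β i, -α i]) h1)
    · exact zero_dvd_iff.mp (h0 ▸ map_dvd (eval ![β i, -α i]) h2)
  rw [not_and_or] at ha
  rcases ha with ha | hb
  · exact (UniqueFactorizationMonoid.isRelPrime_iff_no_prime_factors ha).mpr
      fun p h1 h2 => hprime p h1 h2
  · exact ((UniqueFactorizationMonoid.isRelPrime_iff_no_prime_factors hb).mpr
      fun p h1 h2 => hprime p h2 h1).symm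

theorem derivation_prod_linearForm_pow (D : Derivation K (MvPolynomial (Fin 2) K)
    (MvPolynomial (Fin 2) K)) (α β δ : ι → K) (hD : ∀ i, D (linearForm (α i) (β i)) = C (δ i))
    (m : ι → ℕ) (hm : ∀ i, 1 ≤ m i) (c : K) :
    D (C c * ∏ i, linearForm (α i) (β i) ^ m i) =
      (C c * ∏ i, linearForm (α i) (β i) ^ (m i - 1)) *
        cofactorSum α β fun i => m i * δ i := by
  have hprod : ∀ s : Finset ι, D (∏ i ∈ s, linearForm (α i) (β i) ^ m i) =
      ∑ i ∈ s, (∏ j ∈ s.erase i, linearForm (α j) (β j) ^ m j) *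
        D (linearForm (α i) (β i) ^ m i) := by
    intro s
    induction s using Finset.induction_on with
    | empty => simp
    | insert i s hi ih =>
      rw [Finset.prod_insert hi, D.leibniz, ih, Finset.sum_insert hi, Finset.erase_insert hi,
        smul_eq_mul, smul_eq_mul, add_comm, Finset.mul_sum]
      congr 1
      refine Finset.sum_congr rfl fun j hj => ?_
      have hij : j ≠ i := fun h => hi (h ▸ hj)
      rw [Finset.erase_insert_of_ne hij.symm,
        Finset.prod_insert (fun h => hi (Finset.mem_of_mem_erase h)), mul_assoc]
  rw [← smul_eq_C_mul, D.map_smul, hprod, smul_eq_C_mul, mul_assoc, cofactorSum, Finset.mul_sum,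
    Finset.mul_sum, Finset.mul_sum]
  refine Finset.sum_congr rfl fun i _ => ?_
  have hsplit : ∏ j ∈ Finset.univ.erase i, linearForm (α j) (β j) ^ m j =
      (∏ j ∈ Finset.univ.erase i, linearForm (α j) (β j) ^ (m j - 1)) *
        ∏ j ∈ Finset.univ.erase i, linearForm (α j) (β j) := by
    rw [← Finset.prod_mul_distrib]
    exact Finset.prod_congr rfl fun j _ => (pow_sub_one_mul (by have := hm j; omega) _).symm
  rw [hsplit, D.leibniz_pow, hD, ← Finset.mul_prod_erase Finset.univ
    (fun j => linearForm (α j) (β j) ^ (m j - 1)) (Finset.mem_univ i)]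
  simp only [smul_eq_mul, nsmul_eq_mul, C_mul, map_natCast]
  ring

end Products

end Helpers

/-- The Hilbert function of `ℂ[x,y]/(f_x, f_y)` for `f` homogeneous of degree
`m ≥ 2` with `s` distinct linear factors. -/
theorem stmt_10 (s : ℕ) (hs : 0 < s) (m : Fin s → ℕ) (hm : ∀ i, 1 ≤ m i)
    (c : ℂ) (hc : c ≠ 0) (α β : Fin s → ℂ) (hnz : ∀ i, (α i, β i) ≠ 0)
    (hdist : ∀ i j, i ≠ j → α i * β j ≠ α j * β i)
    (f : MvPolynomial (Fin 2) ℂ)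
    (hf : f = C c * ∏ i, (C (α i) * X 0 + C (β i) * X 1) ^ m i)
    (M : ℕ) (hM : M = ∑ i, m i) (hM2 : 2 ≤ M) :
    (∀ d : ℕ, d ≤ M - 2 →
      Module.finrank ℂ (quotComponent f d) = d + 1) ∧
    (∀ d : ℕ, M - 1 ≤ d → d ≤ M + s - 3 →
      Module.finrank ℂ (quotComponent f d) = 2 * M - 3 - d) ∧
    (∀ d : ℕ, M + s - 2 ≤ d →
      Module.finrank ℂ (quotComponent f d) = M - s) := by
  have hpos : Nonempty (Fin s) := ⟨⟨0, hs⟩⟩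
  have hsM : s ≤ M := by
    have h := Finset.sum_le_sum fun i (_ : i ∈ Finset.univ) => hm i
    rw [hM]
    simpa using h
  set g : MvPolynomial (Fin 2) ℂ := C c * ∏ i, linearForm (α i) (β i) ^ (m i - 1) with hgdef
  set a := cofactorSum α β fun i => (m i : ℂ) * α i
  set b := cofactorSum α β fun i => (m i : ℂ) * β i
  have hfx : pderiv 0 f = g * a := by
    rw [hf]
    refine derivation_prod_linearForm_pow (pderiv 0) α β α (fun i => ?_) m hm c
    simp [linearForm]
  have hfy : pderiv 1 f = g * b := by
    rw [hf]
    refine derivation_prod_linearForm_pow (pderiv 1) α β β (fun i => ?_) m hm c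
    simp [linearForm]
  have hg : g ≠ 0 := mul_ne_zero (C_ne_zero.mpr hc)
    (Finset.prod_ne_zero_iff.mpr fun i _ => pow_ne_zero _ (linearForm_ne_zero (hnz i)))
  have ha : a.IsHomogeneous (s - 1) := by
    simpa using cofactorSum_isHomogeneous α β fun i => (m i : ℂ) * α i
  have hb : b.IsHomogeneous (s - 1) := by
    simpa using cofactorSum_isHomogeneous α β fun i => (m i : ℂ) * β i
  have hab : IsRelPrime a b := by
    refine isRelPrime_cofactorSum hnz hdist (fun i => ?_) ?_
    · have := hm i
      exact_mod_cast (by omega : m i ≠ 0)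
    · exact_mod_cast (by omega : ∑ i, m i ≠ 0)
  have hfM : f.IsHomogeneous M := by
    have h := (IsHomogeneous.prod Finset.univ (fun i => linearForm (α i) (β i) ^ m i) _
      fun i _ => (linearForm_isHomogeneous (α i) (β i)).pow (m i)).C_mul c
    rw [hf, hM]
    simpa [linearForm] using h
  have hF : (g * a).IsHomogeneous (M - 1) := hfx ▸ hfM.pderiv
  have hG : (g * b).IsHomogeneous (M - 1) := hfy ▸ hfM.pderiv
  have hquot : ∀ d, Module.finrank ℂ (quotComponent f d) + Module.finrank ℂ
      ↥(homogeneousSubmodule (Fin 2) ℂ d ⊓ (Ideal.span {g * a, g * b}).restrictScalars ℂ) =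
      d + 1 := by
    intro d
    have h := finrank_map_mkQ_add_finrank_inf (Ideal.span {pderiv 0 f, pderiv 1 f}) d
    rw [finrank_homogeneousSubmodule_fin_two] at h
    rw [← hfx, ← hfy]
    exact h
  have hideal : ∀ n, Module.finrank ℂ ↥(homogeneousSubmodule (Fin 2) ℂ (M - 1 + n) ⊓
      (Ideal.span {g * a, g * b}).restrictScalars ℂ) +
      Module.finrank ℂ (LinearMap.ker (formCombination (g * a) (g * b) n)) =
      (n + 1) + (n + 1) := by
    intro n
    rw [← range_formCombination hF hG, LinearMap.finrank_range_add_finrank_ker,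
      Module.finrank_prod, finrank_homogeneousSubmodule_fin_two]
  refine ⟨fun d hd => ?_, fun d hd hd' => ?_, fun d hd => ?_⟩
  · have h := hquot d
    rw [homogeneousSubmodule_inf_span_pair_of_lt hF hG (by omega), finrank_bot] at h
    exact h
  · obtain ⟨n, rfl⟩ := Nat.exists_eq_add_of_le hd
    have h := hideal n
    rw [ker_formCombination_eq_bot hg ha hb hab (by omega), finrank_bot] at h
    have := hquot (M - 1 + n)
    omega
  · obtain ⟨n, rfl⟩ := Nat.exists_eq_add_of_le (show M - 1 ≤ d by omega)
    have h := hideal n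
    have hq := hquot (M - 1 + n)
    by_cases hn : n < s - 1
    · rw [ker_formCombination_eq_bot hg ha hb hab hn, finrank_bot] at h
      omega
    · obtain ⟨r, rfl⟩ := Nat.exists_eq_add_of_le (not_lt.mp hn)
      rw [finrank_ker_formCombination hg ha hb hab, finrank_homogeneousSubmodule_fin_two] at h
      omega
end
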